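/- arXiv:2006.14455 — 2 statements merged into one kernel-verified Lean document; each statement's English description precedes it below -/
import Mathlib

section
/- Let b be a slowly varying function and q ∈ (0,∞]. Then L^{(1,q,b)} ≠ L^{1,q,b}; that is, for p = 1 the Lorentz–Karamata spaces defined via the maximal function f** and via the rearrangement f* never coincide. -/
open MeasureTheory Set Filter ENNReal Topology

noncomputable section

/-- `f ≈ g` on `S`: two-sided equivalence with positive constants. -/
def EquivOn (f g : ℝ → ℝ) (S : Set ℝ) : Prop :=
  ∃ c C : ℝ, 0 < c ∧ 0 < C ∧ ∀ t ∈ S, c * g t ≤ f t ∧ f t ≤ C * g t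

/-- A measurable positive function on `(0,∞)` is slowly varying if for every `ε > 0`,
`t ^ ε * b t` is equivalent to a non-decreasing function and `t ^ (-ε) * b t` is
equivalent to a non-increasing function on `(0,∞)`. -/
def IsSlowlyVarying (b : ℝ → ℝ) : Prop :=
  Measurable b ∧ (∀ t ∈ Set.Ioi (0:ℝ), 0 < b t) ∧
    ∀ ε : ℝ, 0 < ε →
      (∃ bp : ℝ → ℝ, MonotoneOn bp (Set.Ioi 0) ∧
        EquivOn (fun t => t ^ ε * b t) bp (Set.Ioi 0)) ∧
      (∃ bm : ℝ → ℝ, AntitoneOn bm (Set.Ioi 0) ∧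
        EquivOn (fun t => t ^ (-ε) * b t) bm (Set.Ioi 0))

/-- The non-increasing rearrangement `f*` (with values in `ℝ≥0∞`). -/
def rearr {X : Type*} [MeasurableSpace X] (μ : Measure X) (f : X → ℝ) (t : ℝ) : ℝ≥0∞ :=
  sInf {s : ℝ≥0∞ | μ {x | s < ENNReal.ofReal |f x|} ≤ ENNReal.ofReal t}

/-- The maximal function `f**(t) = (1/t) ∫₀ᵗ f*`. -/
def maxf {X : Type*} [MeasurableSpace X] (μ : Measure X) (f : X → ℝ) (t : ℝ) : ℝ≥0∞ :=
  (ENNReal.ofReal t)⁻¹ * ∫⁻ s in Set.Ioo (0:ℝ) t, rearr μ f s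

/-- The `L^q` "norm" over a subset `S ⊆ ℝ` of an `ℝ≥0∞`-valued function. -/
def lqNorm (q : ℝ≥0∞) (S : Set ℝ) (g : ℝ → ℝ≥0∞) : ℝ≥0∞ :=
  if q = ∞ then essSup g (volume.restrict S)
  else (∫⁻ t in S, g t ^ q.toReal) ^ (1 / q.toReal)

/-- The Lorentz–Karamata functional `‖f‖_{p,q,b}`. -/
def lkNorm {X : Type*} [MeasurableSpace X] (μ : Measure X) (p q : ℝ≥0∞) (b : ℝ → ℝ)
    (f : X → ℝ) : ℝ≥0∞ :=
  lqNorm q (Set.Ioi 0)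
    (fun t => ENNReal.ofReal (t ^ (p⁻¹.toReal - q⁻¹.toReal) * b t) * rearr μ f t)

/-- The Lorentz–Karamata functional `‖f‖_{(p,q,b)}` defined via the maximal function. -/
def lkMaxNorm {X : Type*} [MeasurableSpace X] (μ : Measure X) (p q : ℝ≥0∞) (b : ℝ → ℝ)
    (f : X → ℝ) : ℝ≥0∞ :=
  lqNorm q (Set.Ioi 0)
    (fun t => ENNReal.ofReal (t ^ (p⁻¹.toReal - q⁻¹.toReal) * b t) * maxf μ f t)

/-- The `L^q(0,∞)` norm of `t ^ (1/p - 1/q) * b t` restricted to `S`. -/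
def weightNorm (p q : ℝ≥0∞) (b : ℝ → ℝ) (S : Set ℝ) : ℝ≥0∞ :=
  lqNorm q S (fun t => ENNReal.ofReal (t ^ (p⁻¹.toReal - q⁻¹.toReal) * b t))

/-- A measure is non-atomic. -/
def IsNonatomic {X : Type*} [MeasurableSpace X] (μ : Measure X) : Prop :=
  ∀ s : Set X, MeasurableSet s → 0 < μ s →
    ∃ t, t ⊆ s ∧ MeasurableSet t ∧ 0 < μ t ∧ μ t < μ s

/-- `b̃(t) = ∫₀ᵗ s⁻¹ b(s) ds`. -/
def svTilde (b : ℝ → ℝ) (t : ℝ) : ℝ≥0∞ :=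
  ∫⁻ s in Set.Ioo (0:ℝ) t, ENNReal.ofReal (s⁻¹ * b s)

/-- `b̃_∞(t) = esssup_{s ∈ (0,t)} b(s)`. -/
def svTildeSup (b : ℝ → ℝ) (t : ℝ) : ℝ≥0∞ :=
  essSup (fun s => ENNReal.ofReal (b s)) (volume.restrict (Set.Ioo (0:ℝ) t))

/-- `b̂(t) = ∫_t^∞ s⁻¹ b(s) ds`. -/
def svHat (b : ℝ → ℝ) (t : ℝ) : ℝ≥0∞ :=
  ∫⁻ s in Set.Ioi t, ENNReal.ofReal (s⁻¹ * b s)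

/-- `b̂_∞(t) = esssup_{s ∈ (t,∞)} b(s)`. -/
def svHatSup (b : ℝ → ℝ) (t : ℝ) : ℝ≥0∞ :=
  essSup (fun s => ENNReal.ofReal (b s)) (volume.restrict (Set.Ioi t))

/-- The associate functional of a functional `N`. -/
def assocNorm {X : Type*} [MeasurableSpace X] (μ : Measure X) (N : (X → ℝ) → ℝ≥0∞)
    (f : X → ℝ) : ℝ≥0∞ :=
  ⨆ (g : X → ℝ) (_ : Measurable g) (_ : N g ≤ 1), ∫⁻ x, ENNReal.ofReal |f x * g x| ∂μ

/-- The conjugate exponent: `q' = q/(q-1)` for `q ∈ (1,∞)`, `1' = ∞`, `∞' = 1`. -/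
def conjE (q : ℝ≥0∞) : ℝ≥0∞ := (1 - q⁻¹)⁻¹

/-- The interval `(0, μ(R))` inside `ℝ`, where `μ(R)` may be infinite. -/
def IooMu {X : Type*} [MeasurableSpace X] (μ : Measure X) : Set ℝ :=
  {t : ℝ | 0 < t ∧ ENNReal.ofReal t < μ Set.univ}

/-- The embedding `L^{p₁,q₁,b₁} ↪ L^{p₂,q₂,b₂}`. -/
def lkEmbed {X : Type*} [MeasurableSpace X] (μ : Measure X) (p1 q1 : ℝ≥0∞) (b1 : ℝ → ℝ)
    (p2 q2 : ℝ≥0∞) (b2 : ℝ → ℝ) : Prop :=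
  ∃ C : ℝ≥0∞, C < ∞ ∧ ∀ f : X → ℝ, Measurable f →
    lkNorm μ p2 q2 b2 f ≤ C * lkNorm μ p1 q1 b1 f

/-- A rearrangement-invariant quasi-Banach function norm. -/
structure IsRIQuasiBFN {X : Type*} [MeasurableSpace X] (μ : Measure X)
    (N : (X → ℝ) → ℝ≥0∞) : Prop where
  abs_eq : ∀ f : X → ℝ, Measurable f → N (fun x => |f x|) = N f
  smul : ∀ (a : ℝ) (f : X → ℝ), Measurable f →
    N (fun x => a * f x) = ENNReal.ofReal |a| * N f
  eq_zero_iff : ∀ f : X → ℝ, Measurable f → (N f = 0 ↔ f =ᵐ[μ] 0)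
  quasi_add : ∃ C : ℝ≥0∞, C < ∞ ∧ ∀ f g : X → ℝ, Measurable f → Measurable g →
    N (fun x => f x + g x) ≤ C * (N f + N g)
  mono : ∀ f g : X → ℝ, Measurable f → Measurable g →
    (∀ᵐ x ∂μ, |f x| ≤ |g x|) → N f ≤ N g
  fatou : ∀ (f : ℕ → X → ℝ) (g : X → ℝ), (∀ n, Measurable (f n)) → Measurable g →
    (∀ᵐ x ∂μ, ∀ n, 0 ≤ f n x) → (∀ᵐ x ∂μ, Monotone fun n => f n x) →
    (∀ᵐ x ∂μ, Filter.Tendsto (fun n => f n x) Filter.atTop (nhds (g x))) →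
    N g = ⨆ n, N (f n)
  ind_lt_top : ∀ E : Set X, MeasurableSet E → μ E < ∞ →
    N (Set.indicator E fun _ => (1:ℝ)) < ∞
  rearr_inv : ∀ f g : X → ℝ, Measurable f → Measurable g →
    rearr μ f = rearr μ g → N f = N g

/-- A rearrangement-invariant Banach function norm. -/
structure IsRIBFN {X : Type*} [MeasurableSpace X] (μ : Measure X)
    (N : (X → ℝ) → ℝ≥0∞) : Prop where
  abs_eq : ∀ f : X → ℝ, Measurable f → N (fun x => |f x|) = N f
  smul : ∀ (a : ℝ) (f : X → ℝ), Measurable f →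
    N (fun x => a * f x) = ENNReal.ofReal |a| * N f
  eq_zero_iff : ∀ f : X → ℝ, Measurable f → (N f = 0 ↔ f =ᵐ[μ] 0)
  add_le : ∀ f g : X → ℝ, Measurable f → Measurable g →
    N (fun x => f x + g x) ≤ N f + N g
  mono : ∀ f g : X → ℝ, Measurable f → Measurable g →
    (∀ᵐ x ∂μ, |f x| ≤ |g x|) → N f ≤ N g
  fatou : ∀ (f : ℕ → X → ℝ) (g : X → ℝ), (∀ n, Measurable (f n)) → Measurable g →
    (∀ᵐ x ∂μ, ∀ n, 0 ≤ f n x) → (∀ᵐ x ∂μ, Monotone fun n => f n x) →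
    (∀ᵐ x ∂μ, Filter.Tendsto (fun n => f n x) Filter.atTop (nhds (g x))) →
    N g = ⨆ n, N (f n)
  ind_lt_top : ∀ E : Set X, MeasurableSet E → μ E < ∞ →
    N (Set.indicator E fun _ => (1:ℝ)) < ∞
  integral_le : ∀ E : Set X, MeasurableSet E → μ E < ∞ →
    ∃ C : ℝ≥0∞, C < ∞ ∧ ∀ f : X → ℝ, Measurable f →
      ∫⁻ x in E, ENNReal.ofReal |f x| ∂μ ≤ C * N f
  rearr_inv : ∀ f g : X → ℝ, Measurable f → Measurable g →
    rearr μ f = rearr μ g → N f = N g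

end


section Nonatomic

variable {X : Type*} [MeasurableSpace X] {μ : Measure X}

lemma IsNonatomic.exists_subset_half (hna : IsNonatomic μ) {s : Set X} (hs : MeasurableSet s)
    (hpos : 0 < μ s) : ∃ t ⊆ s, MeasurableSet t ∧ 0 < μ t ∧ 2 * μ t ≤ μ s := by
  obtain ⟨t, hts, ht, htpos, htlt⟩ := hna s hs hpos
  have hadd : μ t + μ (s \ t) = μ s := by
    rw [← measure_union disjoint_sdiff_right (hs.diff ht), union_sdiff_cancel hts]
  rcases le_total (μ t) (μ (s \ t)) with h | h
  · exact ⟨t, hts, ht, htpos, by rw [← hadd, two_mul]; gcongr⟩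
  · refine ⟨s \ t, sdiff_subset, hs.diff ht, ?_, by rw [← hadd, two_mul]; gcongr⟩
    rw [pos_iff_ne_zero]
    intro h0
    rw [h0, add_zero] at hadd
    exact htlt.ne hadd

lemma IsNonatomic.exists_subset_small (hna : IsNonatomic μ) {s : Set X} (hs : MeasurableSet s)
    (hpos : 0 < μ s) {ε : ℝ≥0∞} (hε : ε ≠ 0) :
    ∃ t ⊆ s, MeasurableSet t ∧ 0 < μ t ∧ μ t ≤ ε := by
  obtain ⟨s₀, hs₀s, hs₀, hs₀pos, hs₀lt⟩ := hna s hs hpos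
  have key : ∀ n : ℕ, ∃ t ⊆ s₀, MeasurableSet t ∧ 0 < μ t ∧ 2 ^ n * μ t ≤ μ s₀ := by
    intro n
    induction n with
    | zero => exact ⟨s₀, subset_rfl, hs₀, hs₀pos, by simp⟩
    | succ n ih =>
      obtain ⟨t, hts, ht, htpos, hle⟩ := ih
      obtain ⟨u, hut, hu, hupos, hule⟩ := hna.exists_subset_half ht htpos
      refine ⟨u, hut.trans hts, hu, hupos, le_trans ?_ hle⟩
      rw [pow_succ, mul_assoc]
      gcongr
  have hfin : μ s₀ ≠ ∞ := hs₀lt.ne_top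
  obtain ⟨n, hn⟩ := ENNReal.exists_nat_mul_gt hε hfin
  obtain ⟨t, hts, ht, htpos, hle⟩ := key n
  refine ⟨t, hts.trans hs₀s, ht, htpos, ?_⟩
  have h2 : ((2 : ℝ≥0∞) ^ n) ≠ 0 := by simp
  have h2' : ((2 : ℝ≥0∞) ^ n) ≠ ∞ := by finiteness
  rw [← ENNReal.mul_le_mul_iff_right h2 h2']
  refine hle.trans (hn.le.trans ?_)
  gcongr
  exact_mod_cast Nat.lt_two_pow_self.le

/-- Sierpiński: a non-atomic measure attains every finite value below the measure of a set. -/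
lemma IsNonatomic.exists_subset_measure_eq (hna : IsNonatomic μ) {s : Set X}
    (hs : MeasurableSet s) {c : ℝ≥0∞} (hc : c ≠ ∞) (hcs : c ≤ μ s) :
    ∃ t ⊆ s, MeasurableSet t ∧ μ t = c := by
  let Adm := {A : Set X // A ⊆ s ∧ MeasurableSet A ∧ μ A ≤ c}
  have step : ∀ (n : ℕ) (A : Adm), ∃ A' : Adm, A.1 ⊆ A'.1 ∧
      ∀ B : Adm, A.1 ⊆ B.1 → μ B.1 ≤ μ A'.1 + (n + 1 : ℝ≥0∞)⁻¹ := by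
    intro n A
    set S : ℝ≥0∞ := ⨆ B : {B : Adm // A.1 ⊆ B.1}, μ B.1.1 with hS
    have hSle : ∀ B : Adm, A.1 ⊆ B.1 → μ B.1 ≤ S := fun B hB =>
      le_iSup (fun B : {B : Adm // A.1 ⊆ B.1} => μ B.1.1) ⟨B, hB⟩
    have hSc : S ≤ c := iSup_le fun B => B.1.2.2.2
    rcases eq_or_ne S 0 with h0 | h0
    · exact ⟨A, subset_rfl, fun B hB => by
        have := hSle B hB
        rw [h0] at this
        exact this.trans zero_le⟩
    · have hlt : S - (n + 1 : ℝ≥0∞)⁻¹ < S :=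
        ENNReal.sub_lt_self (ne_top_of_le_ne_top hc hSc) h0
          (ENNReal.inv_ne_zero.2 (by finiteness))
      obtain ⟨⟨A', hA'⟩, hlt'⟩ := lt_iSup_iff.1 hlt
      exact ⟨A', hA', fun B hB => (hSle B hB).trans (tsub_le_iff_right.1 hlt'.le)⟩
  choose next hnext hbest using step
  let A : ℕ → Adm := fun n => Nat.rec ⟨∅, empty_subset _, MeasurableSet.empty, by simp⟩ next n
  have hA : ∀ n, A (n + 1) = next n (A n) := fun n => rfl
  have hmono : Monotone fun n => (A n).1 := monotone_nat_of_le_succ fun n => hnext n (A n)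
  set U := ⋃ n, (A n).1 with hU
  have hUs : U ⊆ s := iUnion_subset fun n => (A n).2.1
  have hUm : MeasurableSet U := MeasurableSet.iUnion fun n => (A n).2.2.1
  have hUc : μ U ≤ c := by
    rw [hU, hmono.measure_iUnion]
    exact iSup_le fun n => (A n).2.2.2
  refine ⟨U, hUs, hUm, le_antisymm hUc (not_lt.1 fun hlt => ?_)⟩
  have hUfin : μ U ≠ ∞ := hlt.ne_top
  have hdpos : 0 < μ (s \ U) := by
    refine lt_of_lt_of_le (tsub_pos_of_lt (hlt.trans_le hcs)) le_measure_sdiff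
  obtain ⟨D, hDs, hD, hDpos, hDle⟩ :=
    hna.exists_subset_small (hs.diff hUm) hdpos (tsub_pos_of_lt hlt).ne'
  have hUD : μ (U ∪ D) = μ U + μ D :=
    measure_union (disjoint_sdiff_right.mono_right hDs) hD
  let B : Adm := ⟨U ∪ D, union_subset hUs (hDs.trans sdiff_subset), hUm.union hD, by
    rw [hUD]; exact add_le_of_le_tsub_left_of_le hUc hDle⟩
  have hle : ∀ n : ℕ, μ D ≤ (n + 1 : ℝ≥0∞)⁻¹ := by
    intro n
    have h1 : μ U + μ D ≤ μ U + (n + 1 : ℝ≥0∞)⁻¹ := by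
      rw [← hUD]
      refine (hbest n (A n) B ((subset_iUnion (fun n => (A n).1) n).trans
        subset_union_left)).trans ?_
      gcongr
      exact subset_iUnion (fun n => (A n).1) (n + 1)
    exact (ENNReal.add_le_add_iff_left hUfin).1 h1
  obtain ⟨n, hn⟩ := ENNReal.exists_inv_nat_lt hDpos.ne'
  refine absurd (hle n) (not_le.2 (lt_of_le_of_lt ?_ hn))
  gcongr
  exact le_self_add

lemma IsNonatomic.exists_disjoint_seq (hna : IsNonatomic μ) (hμ : μ Set.univ = ∞)
    (v : ℕ → ℝ≥0∞) (hv : ∀ n, v n ≠ ∞) :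
    ∃ E : ℕ → Set X, (∀ n, MeasurableSet (E n)) ∧ (∀ n, μ (E n) = v n) ∧
      Pairwise (Function.onFun Disjoint E) := by
  let Fin' := {A : Set X // MeasurableSet A ∧ μ A ≠ ∞}
  have step : ∀ (n : ℕ) (A : Fin'), ∃ D ⊆ A.1ᶜ, MeasurableSet D ∧ μ D = v n := by
    intro n A
    refine hna.exists_subset_measure_eq A.2.1.compl (hv n) ?_
    rw [measure_compl A.2.1 A.2.2, hμ, ENNReal.top_sub A.2.2]
    exact le_top
  choose D hDsub hDm hDv using step
  let U : ℕ → Fin' := fun n => Nat.rec ⟨∅, MeasurableSet.empty, by simp⟩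
    (fun n A => ⟨A.1 ∪ D n A, A.2.1.union (hDm n A),
      ((measure_union_le _ _).trans_lt (ENNReal.add_lt_top.2
        ⟨A.2.2.lt_top, by rw [hDv]; exact (hv n).lt_top⟩)).ne⟩) n
  have hU : ∀ n, (U (n + 1)).1 = (U n).1 ∪ D n (U n) := fun n => rfl
  have hmono : Monotone fun n => (U n).1 :=
    monotone_nat_of_le_succ fun n => by rw [hU]; exact subset_union_left
  refine ⟨fun n => D n (U n), fun n => hDm _ _, fun n => hDv _ _, ?_⟩
  rw [pairwise_disjoint_on]
  intro m n hmn
  refine Disjoint.mono_left ?_ (disjoint_compl_right.mono_right (hDsub n (U n)))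
  exact (hU m ▸ subset_union_right : D m (U m) ⊆ (U (m + 1)).1).trans (hmono hmn)

/-- Any antitone function on `(0,∞)` is comparable, up to dilation, with a rearrangement. -/
lemma IsNonatomic.exists_rearr_between (hna : IsNonatomic μ) (hμ : μ Set.univ = ∞)
    (h : ℝ → ℝ≥0∞) (hanti : AntitoneOn h (Ioi 0)) (hfin : ∀ t, 0 < t → h t ≠ ∞) :
    ∃ f : X → ℝ, Measurable f ∧
      ∀ t, 0 < t → h (2 * t) ≤ rearr μ f t ∧ rearr μ f t ≤ h t := by
  let I : ℤ → Set ℝ := fun n => Ico ((2 : ℝ) ^ n) (2 ^ (n + 1))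
  have hImono : Monotone fun n : ℤ => (2 : ℝ) ^ n := zpow_right_mono₀ one_le_two
  have hIdisj : Pairwise (Function.onFun Disjoint I) := hImono.pairwise_disjoint_on_Ico_succ
  obtain ⟨E', hE'm, hE'v, hE'd⟩ := hna.exists_disjoint_seq hμ
    (fun k => volume (I (Equiv.intEquivNat.symm k))) (fun k => by simp [I])
  let E : ℤ → Set X := fun n => E' (Equiv.intEquivNat n)
  have hEm : ∀ n, MeasurableSet (E n) := fun n => hE'm _
  have hEv : ∀ n, μ (E n) = volume (I n) := fun n => by simp [E, hE'v]
  have hEd : Pairwise (Function.onFun Disjoint E) :=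
    hE'd.comp_of_injective Equiv.intEquivNat.injective
  have hvol : ∀ S : Set ℤ, μ (⋃ n : S, E n) = volume (⋃ n : S, I n) := by
    intro S
    rw [measure_iUnion (hEd.comp_of_injective Subtype.val_injective) fun n => hEm n,
      measure_iUnion (hIdisj.comp_of_injective Subtype.val_injective) fun n => measurableSet_Ico]
    exact tsum_congr fun n => hEv n
  let v : ℤ → ℝ≥0∞ := fun n => h (2 ^ (n + 1))
  have hvfin : ∀ n, v n ≠ ∞ := fun n => hfin _ (by positivity)
  let g : X → ℝ≥0∞ := fun x => ∑' n, (E n).indicator (fun _ => v n) x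
  have hg_on : ∀ n, ∀ x ∈ E n, g x = v n := by
    intro n x hx
    rw [← indicator_of_mem hx fun _ => v n]
    refine tsum_eq_single n fun m hm => indicator_of_notMem (fun hxm => ?_) _
    exact (hEd hm).le_bot ⟨hxm, hx⟩
  have hg_off : ∀ x, (∀ n, x ∉ E n) → g x = 0 := by
    intro x hx
    simp [g, hx]
  have hgm : Measurable g :=
    Measurable.tsum fun n => measurable_const.indicator (hEm n)
  have hgfin : ∀ x, g x ≠ ∞ := by
    intro x
    by_cases hx : ∃ n, x ∈ E n
    · obtain ⟨n, hn⟩ := hx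
      rw [hg_on n x hn]
      exact hvfin n
    · push Not at hx
      rw [hg_off x hx]
      exact zero_ne_top
  have hlevel : ∀ s : ℝ≥0∞, {x | s < ENNReal.ofReal |(g x).toReal|} =
      ⋃ n : {n | s < v n}, E n := by
    intro s
    ext x
    rw [mem_ofPred_eq, abs_of_nonneg toReal_nonneg, ofReal_toReal (hgfin x), mem_iUnion]
    constructor
    · intro hs
      by_cases hx : ∃ n, x ∈ E n
      · obtain ⟨n, hn⟩ := hx
        rw [hg_on n x hn] at hs
        exact ⟨⟨n, hs⟩, hn⟩
      · push Not at hx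
        rw [hg_off x hx] at hs
        exact absurd hs _root_.not_lt_zero
    · rintro ⟨⟨n, hs⟩, hn⟩
      rwa [hg_on n x hn]
  refine ⟨fun x => (g x).toReal, hgm.ennreal_toReal, fun t ht => ⟨?_, ?_⟩⟩
  · refine le_sInf fun s hs => not_lt.1 fun hlt => ?_
    rw [mem_ofPred_eq, hlevel, hvol] at hs
    obtain ⟨N, hN1, hN2⟩ := exists_mem_Ico_zpow ht _root_.one_lt_two
    have hsub : Ioo (0 : ℝ) (2 ^ (N + 1)) ⊆ ⋃ n : {n | s < v n}, I n := by
      intro y hy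
      obtain ⟨n, hn⟩ := exists_mem_Ico_zpow hy.1 _root_.one_lt_two
      have hnN : n < N + 1 := (zpow_lt_zpow_iff_right₀ _root_.one_lt_two).1 (hn.1.trans_lt hy.2)
      refine mem_iUnion.2 ⟨⟨n, lt_of_lt_of_le hlt ?_⟩, hn⟩
      have h2t : (0 : ℝ) < 2 * t := by positivity
      refine hanti (mem_Ioi.2 (by positivity)) h2t ?_
      calc (2 : ℝ) ^ (n + 1) ≤ 2 ^ (N + 1) := hImono (by lia)
        _ = 2 * 2 ^ N := by rw [zpow_add_one₀ two_ne_zero, mul_comm]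
        _ ≤ 2 * t := by gcongr
    have hle := (measure_mono hsub).trans hs
    rw [Real.volume_Ioo, sub_zero, ENNReal.ofReal_le_ofReal_iff ht.le] at hle
    exact absurd hN2 (not_lt.2 hle)
  · refine sInf_le ?_
    rw [mem_ofPred_eq, hlevel, hvol]
    have hsub : (⋃ n : {n | h t < v n}, I n) ⊆ Ioo 0 t := by
      refine iUnion_subset fun ⟨n, hn⟩ y hy => ⟨lt_of_lt_of_le (by positivity) hy.1, ?_⟩
      by_contra! hty
      exact absurd (hanti ht (mem_Ioi.2 (by positivity)) (hty.trans hy.2.le)) (not_le.2 hn)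
    simpa using measure_mono (μ := volume) hsub

end Nonatomic

section SlowlyVarying

variable {b : ℝ → ℝ}

lemma IsSlowlyVarying.pos (hb : IsSlowlyVarying b) {t : ℝ} (ht : 0 < t) : 0 < b t :=
  hb.2.1 t ht

lemma IsSlowlyVarying.exists_rpow_mul_le (hb : IsSlowlyVarying b) {ε : ℝ} (hε : 0 < ε) :
    ∃ K, 0 < K ∧ ∀ s t, 0 < s → s ≤ t → s ^ ε * b s ≤ K * (t ^ ε * b t) := by
  obtain ⟨⟨bp, hmono, c, C, hc, hC, h⟩, -⟩ := hb.2.2 ε hε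
  refine ⟨C / c, by positivity, fun s t hs hst => ?_⟩
  have ht : 0 < t := hs.trans_le hst
  calc s ^ ε * b s ≤ C * bp s := (h s hs).2
    _ ≤ C * bp t := by gcongr; exact hmono hs ht hst
    _ = C / c * (c * bp t) := by field_simp
    _ ≤ C / c * (t ^ ε * b t) :=
      mul_le_mul_of_nonneg_left (h t ht).1 (by positivity)

lemma IsSlowlyVarying.exists_rpow_neg_mul_le (hb : IsSlowlyVarying b) {ε : ℝ} (hε : 0 < ε) :
    ∃ K, 0 < K ∧ ∀ s t, 0 < s → s ≤ t → t ^ (-ε) * b t ≤ K * (s ^ (-ε) * b s) := by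
  obtain ⟨-, bm, hanti, c, C, hc, hC, h⟩ := hb.2.2 ε hε
  refine ⟨C / c, by positivity, fun s t hs hst => ?_⟩
  have ht : 0 < t := hs.trans_le hst
  calc t ^ (-ε) * b t ≤ C * bm t := (h t ht).2
    _ ≤ C * bm s := by gcongr; exact hanti hs ht hst
    _ = C / c * (c * bm s) := by field_simp
    _ ≤ C / c * (s ^ (-ε) * b s) :=
      mul_le_mul_of_nonneg_left (h s hs).1 (by positivity)

lemma IsSlowlyVarying.exists_doubling (hb : IsSlowlyVarying b) :
    ∃ K, 0 < K ∧ ∀ s t, 0 < s → s ≤ t → t ≤ 2 * s → b s ≤ K * b t ∧ b t ≤ K * b s := by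
  obtain ⟨K₁, hK₁, h₁⟩ := hb.exists_rpow_mul_le one_pos
  obtain ⟨K₂, hK₂, h₂⟩ := hb.exists_rpow_neg_mul_le one_pos
  refine ⟨2 * (K₁ + K₂), by positivity, fun s t hs hst hts => ?_⟩
  have ht : 0 < t := hs.trans_le hst
  have hbs := hb.pos hs
  have hbt := hb.pos ht
  have e₁ := h₁ s t hs hst
  have e₂ := h₂ s t hs hst
  simp only [Real.rpow_one, Real.rpow_neg_one] at e₁ e₂
  constructor
  · have : s * b s ≤ s * (2 * K₁ * b t) := by
      calc s * b s ≤ K₁ * (t * b t) := e₁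
        _ ≤ K₁ * (2 * s * b t) := by gcongr
        _ = s * (2 * K₁ * b t) := by ring
    have := le_of_mul_le_mul_left this hs
    have : 0 < K₂ * b t := by positivity
    linarith
  · have : s * b t ≤ s * (2 * K₂ * b s) := by
      calc s * b t = s * t * (t⁻¹ * b t) := by field_simp
        _ ≤ s * t * (K₂ * (s⁻¹ * b s)) := by gcongr
        _ = t * (K₂ * b s) := by field_simp
        _ ≤ 2 * s * (K₂ * b s) := by gcongr
        _ = s * (2 * K₂ * b s) := by ring
    have := le_of_mul_le_mul_left this hs
    have : 0 < K₁ * b s := by positivity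
    linarith

lemma IsSlowlyVarying.exists_mul_pow_le_rpow (hb : IsSlowlyVarying b) {r : ℝ} (hr : 0 < r)
    {θ : ℝ} (hθ : 0 < θ) (hθ' : θ < 1) :
    ∃ k, 0 < k ∧ ∀ n : ℕ, k * θ ^ n ≤ b (2 ^ n) ^ r := by
  have hlog : Real.logb 2 θ < 0 := Real.logb_neg one_lt_two hθ hθ'
  obtain ⟨K, hK, h⟩ := hb.exists_rpow_mul_le (ε := -Real.logb 2 θ / r)
    (div_pos (neg_pos.2 hlog) hr)
  have hb1 := hb.pos one_pos
  refine ⟨(b 1 / K) ^ r, by positivity, fun n => ?_⟩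
  have hbn := hb.pos (t := 2 ^ n) (by positivity)
  have e := h 1 (2 ^ n) one_pos (one_le_pow₀ one_le_two)
  rw [Real.one_rpow, one_mul] at e
  have hpow : (((2 : ℝ) ^ n) ^ (-Real.logb 2 θ / r)) ^ r = (θ ^ n)⁻¹ := by
    rw [← Real.rpow_mul (by positivity), div_mul_cancel₀ _ hr.ne', ← Real.rpow_natCast,
      ← Real.rpow_mul (by positivity), mul_comm, Real.rpow_mul (by positivity),
      Real.rpow_neg (by positivity), Real.rpow_logb (by positivity) (by norm_num) hθ,
      Real.rpow_natCast, inv_pow]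
  have e' : b 1 / K ≤ ((2 : ℝ) ^ n) ^ (-Real.logb 2 θ / r) * b (2 ^ n) := by
    rw [div_le_iff₀ hK]
    linarith
  have e'' := Real.rpow_le_rpow (by positivity) e' hr.le
  rw [Real.mul_rpow (by positivity) hbn.le, hpow] at e''
  calc (b 1 / K) ^ r * θ ^ n ≤ ((θ ^ n)⁻¹ * b (2 ^ n) ^ r) * θ ^ n := by gcongr
    _ = b (2 ^ n) ^ r := by field_simp

lemma IsSlowlyVarying.exists_mul_pow_le_inv (hb : IsSlowlyVarying b)
    {θ : ℝ} (hθ : 0 < θ) (hθ' : θ < 1) :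
    ∃ k, 0 < k ∧ ∀ n : ℕ, k * θ ^ n ≤ (b ((1 / 2) ^ n))⁻¹ := by
  have hlog : Real.logb 2 θ < 0 := Real.logb_neg one_lt_two hθ hθ'
  obtain ⟨K, hK, h⟩ := hb.exists_rpow_mul_le (neg_pos.2 hlog)
  have hb1 := hb.pos one_pos
  refine ⟨(K * b 1)⁻¹, by positivity, fun n => ?_⟩
  have hbn := hb.pos (t := (1 / 2) ^ n) (by positivity)
  have e := h ((1 / 2) ^ n) 1 (by positivity) (pow_le_one₀ (by norm_num) (by norm_num))
  rw [Real.one_rpow, one_mul] at e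
  have hpow : ((1 / 2 : ℝ) ^ n) ^ (-Real.logb 2 θ) = θ ^ n := by
    rw [← Real.rpow_natCast, ← Real.rpow_mul (by positivity), mul_comm,
      Real.rpow_mul (by positivity), one_div, Real.inv_rpow (by positivity),
      ← Real.rpow_neg (by positivity), neg_neg,
      Real.rpow_logb (by positivity) (by norm_num) hθ, Real.rpow_natCast]
  rw [hpow] at e
  rw [inv_mul_eq_div, div_le_iff₀ (by positivity), ← div_eq_inv_mul, le_div_iff₀ hbn]
  exact e

end SlowlyVarying

/-- A positive sequence whose tail sums are dominated by its terms decays geometrically. -/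
lemma false_of_tsum_tail_le {x : ℕ → ℝ} (hx : ∀ n, 0 < x n)
    (hlow : ∀ θ : ℝ, 0 < θ → θ < 1 → ∃ k, 0 < k ∧ ∀ n : ℕ, k * θ ^ n ≤ x n)
    {C : ℝ} (hC : 0 < C)
    (h : ∀ n, ∑' i, ENNReal.ofReal (x (n + i)) ≤ ENNReal.ofReal (C * x n)) : False := by
  have hsum : ∀ n, Summable fun i => x (n + i) := by
    intro n
    have := ENNReal.summable_toReal ((h n).trans_lt ofReal_lt_top).ne
    simpa only [ENNReal.toReal_ofReal (hx _).le] using this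
  set S : ℕ → ℝ := fun n => ∑' i, x (n + i) with hS
  have hSle : ∀ n, S n ≤ C * x n := by
    intro n
    have := h n
    rw [← ENNReal.ofReal_tsum_of_nonneg (fun i => (hx _).le) (hsum n)] at this
    exact (ENNReal.ofReal_le_ofReal_iff (mul_pos hC (hx n)).le).1 this
  have hSsucc : ∀ n, S n = x n + S (n + 1) := by
    intro n
    have := (hsum n).tsum_eq_zero_add
    simp only [hS, this, add_zero]
    congr 2
    ext i
    congr 1
    ring
  have hS0 : ∀ n, 0 < S n := fun n => (hsum n).tsum_pos (fun i => (hx _).le) 0 (hx _)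
  have hxS : ∀ n, x n ≤ S n := fun n => by
    have := hSsucc n
    have := hS0 (n + 1)
    linarith
  set φ : ℝ := C / (1 + C) with hφ
  have hφ0 : 0 < φ := by positivity
  have hφ1 : φ < 1 := by rw [hφ, div_lt_one (by positivity)]; linarith
  have hstep : ∀ n, S (n + 1) ≤ φ * S n := by
    intro n
    rw [hφ, div_mul_eq_mul_div, le_div_iff₀ (by positivity)]
    have := hSle n
    have e := hSsucc n
    have : C * S n = C * x n + C * S (n + 1) := by rw [e]; ring
    have := hx n
    linarith
  have hgeom : ∀ n, S n ≤ φ ^ n * S 0 := by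
    intro n
    induction n with
    | zero => simp
    | succ n ih =>
      calc S (n + 1) ≤ φ * S n := hstep n
        _ ≤ φ * (φ ^ n * S 0) := by gcongr
        _ = φ ^ (n + 1) * S 0 := by ring
  obtain ⟨θ, hθφ, hθ1⟩ := exists_between hφ1
  have hθ0 : 0 < θ := hφ0.trans hθφ
  obtain ⟨k, hk, hkx⟩ := hlow θ hθ0 hθ1
  obtain ⟨n, hn⟩ := pow_unbounded_of_one_lt (S 0 / k) ((one_lt_div hφ0).2 hθφ)
  have e : k * θ ^ n ≤ φ ^ n * S 0 := (hkx n).trans ((hxS n).trans (hgeom n))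
  rw [div_lt_iff₀ hk, div_pow, div_mul_eq_mul_div, lt_div_iff₀ (by positivity)] at hn
  linarith

section Witnesses

variable {b : ℝ → ℝ}

lemma IsSlowlyVarying.exists_tail_lintegral_ge (hb : IsSlowlyVarying b) {r : ℝ} (hr : 0 < r)
    {M : ℝ} (hM : 0 < M) :
    ∃ a, 0 < a ∧ ENNReal.ofReal (M * b a ^ r) ≤
      ∫⁻ t in Ioi a, ENNReal.ofReal (t⁻¹ * b t ^ r) := by
  by_contra! H
  obtain ⟨K, hK, hdbl⟩ := hb.exists_doubling
  have hbp : ∀ n : ℕ, 0 < b (2 ^ n) := fun n => hb.pos (by positivity)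
  have hblock : ∀ m : ℕ, ENNReal.ofReal (b (2 ^ m) ^ r) ≤ ENNReal.ofReal (2 * K ^ r) *
      ∫⁻ t in Ioc ((2 : ℝ) ^ m) (2 ^ (m + 1)), ENNReal.ofReal (t⁻¹ * b t ^ r) := by
    intro m
    have hbm := hbp m
    calc ENNReal.ofReal (b (2 ^ m) ^ r)
        = ENNReal.ofReal (2 * K ^ r) * ∫⁻ _ in Ioc ((2 : ℝ) ^ m) (2 ^ (m + 1)),
            ENNReal.ofReal ((2 * 2 ^ m)⁻¹ * (b (2 ^ m) / K) ^ r) := by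
          rw [setLIntegral_const, Real.volume_Ioc, ← ENNReal.ofReal_mul (by positivity),
            ← ENNReal.ofReal_mul (by positivity), Real.div_rpow hbm.le hK.le]
          congr 1
          rw [pow_succ]
          field_simp
          ring
      _ ≤ _ := by
          refine mul_le_mul_right ?_ _
          refine setLIntegral_mono' measurableSet_Ioc fun t ht => ?_
          have hm0 : (0 : ℝ) < 2 ^ m := by positivity
          have ht0 : 0 < t := hm0.trans ht.1
          have ht2 : t ≤ 2 * 2 ^ m := by rw [← pow_succ']; exact ht.2
          refine ENNReal.ofReal_le_ofReal ?_
          gcongr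
          rw [div_le_iff₀' hK]
          exact (hdbl _ t hm0 ht.1.le ht2).1
  refine false_of_tsum_tail_le (x := fun n => b (2 ^ n) ^ r) (C := 2 * K ^ r * M)
    (fun n => Real.rpow_pos_of_pos (hbp n) r)
    (fun θ h0 h1 => hb.exists_mul_pow_le_rpow hr h0 h1) (by positivity) fun n => ?_
  have hmono : Monotone fun i : ℕ => (2 : ℝ) ^ (n + i) :=
    fun i j hij => pow_le_pow_right₀ one_le_two (by lia)
  have hdisj : Pairwise (Function.onFun Disjoint
      fun i : ℕ => Ioc ((2 : ℝ) ^ (n + i)) (2 ^ (n + i + 1))) :=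
    hmono.pairwise_disjoint_on_Ioc_succ
  have hsub : (⋃ i : ℕ, Ioc ((2 : ℝ) ^ (n + i)) (2 ^ (n + i + 1))) ⊆ Ioi (2 ^ n) :=
    iUnion_subset fun i t ht => lt_of_le_of_lt (hmono (Nat.zero_le i)) ht.1
  calc ∑' i, ENNReal.ofReal (b (2 ^ (n + i)) ^ r)
      ≤ ∑' i, ENNReal.ofReal (2 * K ^ r) *
        ∫⁻ t in Ioc ((2 : ℝ) ^ (n + i)) (2 ^ (n + i + 1)), ENNReal.ofReal (t⁻¹ * b t ^ r) :=
        ENNReal.tsum_le_tsum fun i => hblock (n + i)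
    _ = ENNReal.ofReal (2 * K ^ r) *
        ∫⁻ t in ⋃ i : ℕ, Ioc ((2 : ℝ) ^ (n + i)) (2 ^ (n + i + 1)),
          ENNReal.ofReal (t⁻¹ * b t ^ r) := by
        rw [ENNReal.tsum_mul_left, lintegral_iUnion (fun i => measurableSet_Ioc) hdisj]
    _ ≤ ENNReal.ofReal (2 * K ^ r) * ENNReal.ofReal (M * b (2 ^ n) ^ r) := by
        gcongr
        exact (lintegral_mono_set hsub).trans (H _ (by positivity)).le
    _ = ENNReal.ofReal (2 * K ^ r * M * b (2 ^ n) ^ r) := by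
        rw [← ENNReal.ofReal_mul (by positivity)]
        congr 1
        ring

lemma IsSlowlyVarying.exists_step_lintegral_le (hb : IsSlowlyVarying b) {r : ℝ} (hr : 0 < r) :
    ∃ D, 0 < D ∧ ∀ a c, 0 < a → 0 < c →
      ∫⁻ t in Ioc 0 a, (ENNReal.ofReal (t ^ (1 - r⁻¹) * b t) *
        ENNReal.ofReal (c / (a * b a))) ^ r ≤ ENNReal.ofReal (D * c ^ r) := by
  obtain ⟨K, hK, h⟩ := hb.exists_rpow_mul_le (ε := 1 / 2) (by norm_num)
  refine ⟨K ^ r * (2 / r), by positivity, fun a c ha hc => ?_⟩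
  have hba := hb.pos ha
  have hpt : ∀ t ∈ Ioc 0 a, (ENNReal.ofReal (t ^ (1 - r⁻¹) * b t) *
      ENNReal.ofReal (c / (a * b a))) ^ r ≤
      ENNReal.ofReal ((K * c * a ^ (-(1 / 2) : ℝ)) ^ r) * ENNReal.ofReal (t ^ (r / 2 - 1)) := by
    intro t ht
    have ht0 : 0 < t := ht.1
    have hbt := hb.pos ht0
    rw [← ENNReal.ofReal_mul (by positivity), ENNReal.ofReal_rpow_of_pos (by positivity),
      ← ENNReal.ofReal_mul (by positivity)]
    refine ENNReal.ofReal_le_ofReal ?_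
    have e₁ : t ^ (r / 2 - 1) = (t ^ (1 / 2 - r⁻¹)) ^ r := by
      rw [← Real.rpow_mul ht0.le]
      congr 1
      field_simp
    rw [e₁, ← Real.mul_rpow (by positivity) (by positivity)]
    refine Real.rpow_le_rpow (by positivity) ?_ hr.le
    have e₂ : t ^ (1 - r⁻¹) = t ^ (1 / 2 - r⁻¹) * t ^ (1 / 2 : ℝ) := by
      rw [← Real.rpow_add ht0]
      congr 1
      ring
    have e₃ : a ^ (-(1 / 2) : ℝ) = a ^ (1 / 2 : ℝ) / a := by
      rw [← Real.rpow_sub_one ha.ne']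
      norm_num
    calc t ^ (1 - r⁻¹) * b t * (c / (a * b a))
        = t ^ (1 / 2 - r⁻¹) * (t ^ (1 / 2 : ℝ) * b t) * (c / (a * b a)) := by rw [e₂]; ring
      _ ≤ t ^ (1 / 2 - r⁻¹) * (K * (a ^ (1 / 2 : ℝ) * b a)) * (c / (a * b a)) := by
          gcongr _ * ?_ * _
          exact h t a ht0 ht.2
      _ = K * c * a ^ (-(1 / 2) : ℝ) * t ^ (1 / 2 - r⁻¹) := by
          rw [e₃]
          field_simp
  have hr1 : -1 < r / 2 - 1 := by linarith [half_pos hr]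
  have hint : ∫⁻ t in Ioc 0 a, ENNReal.ofReal (t ^ (r / 2 - 1)) =
      ENNReal.ofReal (a ^ (r / 2) / (r / 2)) := by
    rw [← ofReal_integral_eq_lintegral_ofReal, ← intervalIntegral.integral_of_le ha.le,
      integral_rpow (Or.inl hr1), sub_add_cancel, Real.zero_rpow (by positivity), sub_zero]
    · exact (intervalIntegrable_iff_integrableOn_Ioc_of_le ha.le).1
        (intervalIntegral.intervalIntegrable_rpow' hr1)
    · exact ae_restrict_of_forall_mem measurableSet_Ioc fun t ht => Real.rpow_nonneg ht.1.le _
  refine (setLIntegral_mono' measurableSet_Ioc hpt).trans ?_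
  rw [lintegral_const_mul' _ _ ofReal_ne_top, hint, ← ENNReal.ofReal_mul (by positivity)]
  refine ENNReal.ofReal_le_ofReal (le_of_eq ?_)
  rw [Real.mul_rpow (by positivity) (by positivity), Real.mul_rpow hK.le hc.le,
    ← Real.rpow_mul ha.le]
  have : a ^ (-(1 / 2) * r) * a ^ (r / 2) = 1 := by
    rw [← Real.rpow_add ha]
    ring_nf
    exact Real.rpow_zero a
  calc K ^ r * c ^ r * a ^ (-(1 / 2) * r) * (a ^ (r / 2) / (r / 2))
      = K ^ r * c ^ r * (a ^ (-(1 / 2) * r) * a ^ (r / 2)) / (r / 2) := by ring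
    _ = K ^ r * (2 / r) * c ^ r := by rw [this]; field_simp

lemma IsSlowlyVarying.exists_Ioo_lt_mul_lintegral (hb : IsSlowlyVarying b) {g : ℝ → ℝ≥0∞}
    (hg : ∀ s t, 0 < t → 2 * t ≤ s → ENNReal.ofReal ((s * b s)⁻¹) ≤ g t) {M : ℝ} (hM : 0 < M) :
    ∃ u v, 0 < u ∧ u < v ∧
      ∀ t ∈ Ioo u v, ENNReal.ofReal M < ENNReal.ofReal (b t) * ∫⁻ s in Ioo 0 t, g s := by
  by_contra! H
  obtain ⟨K, hK, hdbl⟩ := hb.exists_doubling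
  have hbp : ∀ n : ℕ, 0 < b ((1 / 2) ^ n) := fun n => hb.pos (by positivity)
  have hblock : ∀ m : ℕ, ENNReal.ofReal (b ((1 / 2) ^ m))⁻¹ ≤ ENNReal.ofReal 4 *
      ∫⁻ t in Ioc ((1 / 2 : ℝ) ^ (m + 1 + 1)) ((1 / 2) ^ (m + 1)), g t := by
    intro m
    have hbm := hbp m
    calc ENNReal.ofReal (b ((1 / 2) ^ m))⁻¹
        = ENNReal.ofReal 4 *
          ∫⁻ _ in Ioc ((1 / 2 : ℝ) ^ (m + 1 + 1)) ((1 / 2) ^ (m + 1)),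
            ENNReal.ofReal (((1 / 2) ^ m * b ((1 / 2) ^ m))⁻¹) := by
          rw [setLIntegral_const, Real.volume_Ioc, ← ENNReal.ofReal_mul (by positivity),
            ← ENNReal.ofReal_mul (by positivity)]
          congr 1
          rw [pow_succ, pow_succ]
          field_simp
          ring
      _ ≤ _ := by
          refine mul_le_mul_right ?_ _
          refine setLIntegral_mono' measurableSet_Ioc fun t ht => ?_
          have ht2 := ht.2
          rw [pow_succ] at ht2
          exact hg _ t (lt_trans (by positivity) ht.1) (by linarith)
  refine false_of_tsum_tail_le (x := fun n => (b ((1 / 2) ^ n))⁻¹)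
    (C := 4 * M * K) (fun n => inv_pos.2 (hbp n))
    (fun θ h0 h1 => hb.exists_mul_pow_le_inv h0 h1) (by positivity) fun n => ?_
  have hanti : Antitone fun i : ℕ => (1 / 2 : ℝ) ^ (n + i + 1) :=
    fun i j hij => pow_le_pow_of_le_one (by norm_num) (by norm_num) (by lia)
  have hdisj : Pairwise (Function.onFun Disjoint
      fun i : ℕ => Ioc ((1 / 2 : ℝ) ^ (n + i + 1 + 1)) ((1 / 2) ^ (n + i + 1))) :=
    hanti.pairwise_disjoint_on_Ioc_succ
  obtain ⟨t, ht, htM⟩ := H ((1 / 2 : ℝ) ^ (n + 1)) ((1 / 2) ^ n) (by positivity)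
    (pow_lt_pow_right_of_lt_one₀ (by norm_num) (by norm_num) (by lia))
  have ht0 : 0 < t := lt_trans (by positivity) ht.1
  have hbt := hb.pos ht0
  have hF : ∫⁻ s in Ioo 0 t, g s ≤ ENNReal.ofReal (M * (b t)⁻¹) := by
    calc ∫⁻ s in Ioo 0 t, g s
        = ENNReal.ofReal (b t)⁻¹ * (ENNReal.ofReal (b t) * ∫⁻ s in Ioo 0 t, g s) := by
          rw [← mul_assoc, ← ENNReal.ofReal_mul (by positivity), inv_mul_cancel₀ hbt.ne',
            ENNReal.ofReal_one, one_mul]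
      _ ≤ ENNReal.ofReal (b t)⁻¹ * ENNReal.ofReal M := by gcongr
      _ = _ := by rw [← ENNReal.ofReal_mul (by positivity), mul_comm]
  have hsub : (⋃ i : ℕ, Ioc ((1 / 2 : ℝ) ^ (n + i + 1 + 1)) ((1 / 2) ^ (n + i + 1))) ⊆
      Ioo 0 t := iUnion_subset fun i s hs => ⟨lt_trans (by positivity) hs.1,
        (hs.2.trans (hanti (Nat.zero_le i))).trans_lt ht.1⟩
  have hbK : (b t)⁻¹ ≤ K * (b ((1 / 2) ^ n))⁻¹ := by
    have ht1 := ht.1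
    rw [pow_succ] at ht1
    have := (hdbl t ((1 / 2) ^ n) ht0 ht.2.le (by linarith)).2
    rwa [← div_eq_mul_inv, inv_eq_one_div, div_le_div_iff₀ hbt (hbp n), one_mul]
  calc ∑' i, ENNReal.ofReal (b ((1 / 2) ^ (n + i)))⁻¹
      ≤ ∑' i, ENNReal.ofReal 4 * ∫⁻ t in Ioc ((1 / 2 : ℝ) ^ (n + i + 1 + 1))
        ((1 / 2) ^ (n + i + 1)), g t := ENNReal.tsum_le_tsum fun i => hblock (n + i)
    _ = ENNReal.ofReal 4 * ∫⁻ t in ⋃ i : ℕ, Ioc ((1 / 2 : ℝ) ^ (n + i + 1 + 1))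
        ((1 / 2) ^ (n + i + 1)), g t := by
        rw [ENNReal.tsum_mul_left, lintegral_iUnion (fun i => measurableSet_Ioc) hdisj]
    _ ≤ ENNReal.ofReal 4 * ENNReal.ofReal (M * (b t)⁻¹) := by
        gcongr
        exact (lintegral_mono_set hsub).trans hF
    _ ≤ ENNReal.ofReal (4 * M * K * (b ((1 / 2) ^ n))⁻¹) := by
        rw [← ENNReal.ofReal_mul (by positivity)]
        refine ENNReal.ofReal_le_ofReal ?_
        calc 4 * (M * (b t)⁻¹) ≤ 4 * (M * (K * (b ((1 / 2) ^ n))⁻¹)) := by gcongr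
          _ = _ := by ring

variable {X : Type*} [MeasurableSpace X] {μ : Measure X}

lemma IsSlowlyVarying.exists_lkNorm_lt_top_lkMaxNorm_eq_top_of_eq_top (hb : IsSlowlyVarying b)
    (hna : IsNonatomic μ) (hμ : μ Set.univ = ∞) :
    ∃ f : X → ℝ, Measurable f ∧ lkNorm μ 1 ∞ b f < ∞ ∧ lkMaxNorm μ 1 ∞ b f = ∞ := by
  obtain ⟨L, hL, hmono⟩ := hb.exists_rpow_mul_le one_pos
  obtain ⟨K, hK, hdbl⟩ := hb.exists_doubling
  let h : ℝ → ℝ≥0∞ := fun t => ⨆ (s : ℝ) (_ : t ≤ s), ENNReal.ofReal ((s * b s)⁻¹)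
  have hle : ∀ t, 0 < t → h t ≤ ENNReal.ofReal (L * (t * b t)⁻¹) := by
    intro t ht
    refine iSup₂_le fun s hs => ENNReal.ofReal_le_ofReal ?_
    have hs0 := ht.trans_le hs
    have hbs := hb.pos hs0
    have hbt := hb.pos ht
    have := hmono t s ht hs
    rw [Real.rpow_one, Real.rpow_one] at this
    rw [← div_eq_mul_inv, inv_eq_one_div, div_le_div_iff₀ (by positivity) (by positivity)]
    linarith
  have hanti : Antitone h := fun s t hst =>
    iSup₂_le fun u hu => le_iSup₂_of_le u (hst.trans hu) le_rfl
  obtain ⟨f, hf, hfh⟩ := hna.exists_rearr_between hμ h (hanti.antitoneOn _)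
    fun t ht => ((hle t ht).trans_lt ofReal_lt_top).ne
  refine ⟨f, hf, ?_, ?_⟩
  · rw [lkNorm, lqNorm, if_pos rfl]
    refine lt_of_le_of_lt (essSup_le_of_ae_le (ENNReal.ofReal L) ?_) ofReal_lt_top
    refine ae_restrict_of_forall_mem measurableSet_Ioi fun t ht => ?_
    have ht0 : 0 < t := ht
    have hbt := hb.pos ht0
    calc _ ≤ ENNReal.ofReal (t * b t) * ENNReal.ofReal (L * (t * b t)⁻¹) := by
          simp only [inv_one, toReal_one, inv_top, toReal_zero, sub_zero, Real.rpow_one]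
          gcongr
          exact (hfh t ht0).2.trans (hle t ht0)
      _ = ENNReal.ofReal L := by
          rw [← ENNReal.ofReal_mul (by positivity)]
          congr 1
          field_simp
  · rw [lkMaxNorm, lqNorm, if_pos rfl]
    set w : ℝ → ℝ≥0∞ := fun t =>
      ENNReal.ofReal (t ^ ((1 : ℝ≥0∞)⁻¹.toReal - (∞ : ℝ≥0∞)⁻¹.toReal) * b t) * maxf μ f t
      with hw
    have hwt : ∀ t, 0 < t → w t = ENNReal.ofReal (b t) * ∫⁻ s in Ioo 0 t, rearr μ f s := by
      intro t ht
      have hbt := hb.pos ht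
      simp only [hw, inv_one, toReal_one, inv_top, toReal_zero, sub_zero, Real.rpow_one, maxf]
      rw [← ENNReal.ofReal_inv_of_pos ht, ← mul_assoc, ← ENNReal.ofReal_mul (by positivity),
        show t * b t * t⁻¹ = b t by field_simp]
    refine ENNReal.eq_top_of_forall_nnreal_le fun x => ?_
    obtain ⟨u, v, hu, huv, hlt⟩ := hb.exists_Ioo_lt_mul_lintegral (g := rearr μ f)
      (fun s t ht hts => (le_iSup₂_of_le s hts le_rfl).trans (hfh t ht).1)
      (M := x + 1) (by positivity)
    have hne : (ae (volume.restrict (Ioo u v))).NeBot := by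
      rw [ae_restrict_neBot, Real.volume_Ioo]
      exact (ENNReal.ofReal_pos.2 (sub_pos.2 huv)).ne'
    have hae := ENNReal.ae_le_essSup (μ := volume.restrict (Ioi (0 : ℝ))) w
    obtain ⟨t, htS, ht⟩ := ((ae_restrict_of_ae_restrict_of_subset
      (fun t ht => hu.trans ht.1) hae).and
      (ae_restrict_mem (measurableSet_Ioo (a := u) (b := v)))).exists
    refine le_trans ?_ htS
    rw [hwt t (hu.trans ht.1), ← ENNReal.ofReal_coe_nnreal]
    exact (ENNReal.ofReal_le_ofReal (by linarith)).trans (hlt t ht).le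

lemma IsSlowlyVarying.exists_lkNorm_lt_top_lkMaxNorm_eq_top_of_ne_top (hb : IsSlowlyVarying b)
    (hna : IsNonatomic μ) (hμ : μ Set.univ = ∞) {q : ℝ≥0∞} (hq : 0 < q) (hq' : q ≠ ∞) :
    ∃ f : X → ℝ, Measurable f ∧ lkNorm μ 1 q b f < ∞ ∧ lkMaxNorm μ 1 q b f = ∞ := by
  set r := q.toReal with hr_def
  have hr : 0 < r := toReal_pos hq.ne' hq'
  have hexp : (1 : ℝ≥0∞)⁻¹.toReal - q⁻¹.toReal = 1 - r⁻¹ := by simp [toReal_inv, hr_def]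
  obtain ⟨D, hD, hstep⟩ := hb.exists_step_lintegral_le hr
  obtain ⟨L, hL, hmono⟩ := hb.exists_rpow_mul_le one_pos
  choose a ha hbig using fun k : ℕ =>
    hb.exists_tail_lintegral_ge hr (M := (4 ^ k) ^ r) (by positivity)
  have hba : ∀ k, 0 < b (a k) := fun k => hb.pos (ha k)
  let c : ℕ → ℝ := fun k => (1 / 2) ^ k
  have hc : ∀ k, 0 < c k := fun k => by positivity
  let g : ℕ → ℝ → ℝ≥0∞ := fun k t =>
    if t ≤ a k then ENNReal.ofReal (c k / (a k * b (a k))) else 0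
  have hgm : ∀ k, Measurable (g k) := fun k =>
    Measurable.ite measurableSet_Iic measurable_const measurable_const
  let h : ℝ → ℝ≥0∞ := fun t => ⨆ k, g k t
  have hanti : Antitone h := by
    intro s t hst
    refine iSup_mono fun k => ?_
    by_cases htk : t ≤ a k
    · simp [g, htk, hst.trans htk]
    · simp [g, htk]
  have hle : ∀ t, 0 < t → h t ≤ ENNReal.ofReal (L * (t * b t)⁻¹) := by
    intro t ht
    refine iSup_le fun k => ?_
    by_cases htk : t ≤ a k
    · simp only [g, htk, if_true]
      refine ENNReal.ofReal_le_ofReal ?_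
      have hbk := hba k
      have hak := ha k
      have hbt := hb.pos ht
      have := hmono t (a k) ht htk
      rw [Real.rpow_one, Real.rpow_one] at this
      have hc1 : c k ≤ 1 := pow_le_one₀ (by norm_num) (by norm_num)
      calc c k / (a k * b (a k)) ≤ 1 / (a k * b (a k)) := by gcongr
        _ ≤ L * (t * b t)⁻¹ := by
          rw [← div_eq_mul_inv, div_le_div_iff₀ (by positivity) (by positivity)]
          linarith
    · simp [g, htk]
  obtain ⟨f, hf, hfh⟩ := hna.exists_rearr_between hμ h (hanti.antitoneOn _)
    fun t ht => ((hle t ht).trans_lt ofReal_lt_top).ne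
  refine ⟨f, hf, ?_, ?_⟩
  · rw [lkNorm, lqNorm, if_neg hq', hexp]
    refine ENNReal.rpow_lt_top_of_nonneg (by positivity) (ne_of_lt ?_)
    have hk : ∀ k, ∫⁻ t in Ioi 0, (ENNReal.ofReal (t ^ (1 - r⁻¹) * b t) * g k t) ^ r ≤
        ENNReal.ofReal (D * ((1 / 2) ^ r) ^ k) := by
      intro k
      rw [← Ioc_union_Ioi_eq_Ioi (ha k).le,
        lintegral_union measurableSet_Ioi (Ioc_disjoint_Ioi le_rfl)]
      have h₁ : ∫⁻ t in Ioc 0 (a k), (ENNReal.ofReal (t ^ (1 - r⁻¹) * b t) * g k t) ^ r =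
          ∫⁻ t in Ioc 0 (a k), (ENNReal.ofReal (t ^ (1 - r⁻¹) * b t) *
            ENNReal.ofReal (c k / (a k * b (a k)))) ^ r :=
        setLIntegral_congr_fun measurableSet_Ioc fun t ht => by simp [g, ht.2]
      have h₂ : ∫⁻ t in Ioi (a k), (ENNReal.ofReal (t ^ (1 - r⁻¹) * b t) * g k t) ^ r = 0 := by
        rw [setLIntegral_congr_fun (g := fun _ => 0) measurableSet_Ioi fun t ht => by
          simp [g, not_le.2 (mem_Ioi.1 ht), hr]]
        simp
      rw [h₁, h₂, add_zero]
      refine (hstep (a k) (c k) (ha k) (hc k)).trans (le_of_eq ?_)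
      congr 2
      rw [← Real.rpow_natCast, ← Real.rpow_mul (by norm_num), mul_comm,
        Real.rpow_mul (by norm_num), Real.rpow_natCast]
    calc ∫⁻ t in Ioi 0, (ENNReal.ofReal (t ^ (1 - r⁻¹) * b t) * rearr μ f t) ^ r
        ≤ ∫⁻ t in Ioi 0, ∑' k, (ENNReal.ofReal (t ^ (1 - r⁻¹) * b t) * g k t) ^ r := by
          refine setLIntegral_mono' measurableSet_Ioi fun t ht => ?_
          calc (ENNReal.ofReal (t ^ (1 - r⁻¹) * b t) * rearr μ f t) ^ r
              ≤ (ENNReal.ofReal (t ^ (1 - r⁻¹) * b t) * h t) ^ r := by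
                gcongr
                exact (hfh t ht).2
            _ = ⨆ k, (ENNReal.ofReal (t ^ (1 - r⁻¹) * b t) * g k t) ^ r := by
                rw [ENNReal.mul_iSup]
                exact (ENNReal.orderIsoRpow r hr).map_iSup _
            _ ≤ _ := iSup_le fun k => ENNReal.le_tsum k
      _ = ∑' k, ∫⁻ t in Ioi 0, (ENNReal.ofReal (t ^ (1 - r⁻¹) * b t) * g k t) ^ r := by
          refine lintegral_tsum fun k => ?_
          have := hb.1
          have := hgm k
          exact Measurable.aemeasurable (by fun_prop)
      _ ≤ ∑' k, ENNReal.ofReal (D * ((1 / 2) ^ r) ^ k) := ENNReal.tsum_le_tsum hk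
      _ < ∞ := Summable.tsum_ofReal_lt_top ((summable_geometric_of_lt_one (by positivity)
          (Real.rpow_lt_one (by norm_num) (by norm_num) hr)).mul_left D)
  · rw [lkMaxNorm, lqNorm, if_neg hq', hexp]
    refine (ENNReal.rpow_eq_top_iff_of_pos (by positivity)).2 ?_
    have hk : ∀ k : ℕ, ENNReal.ofReal ((1 / 2) ^ r * (2 ^ r) ^ k) ≤
        ∫⁻ t in Ioi 0, (ENNReal.ofReal (t ^ (1 - r⁻¹) * b t) * maxf μ f t) ^ r := by
      intro k
      have hak := ha k
      have hbk := hba k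
      have hck := hc k
      have hF : ENNReal.ofReal (c k / (2 * b (a k))) ≤ ∫⁻ s in Ioo 0 (a k / 2), rearr μ f s := by
        calc ENNReal.ofReal (c k / (2 * b (a k)))
            = ∫⁻ _ in Ioo 0 (a k / 2), ENNReal.ofReal (c k / (a k * b (a k))) := by
              rw [setLIntegral_const, Real.volume_Ioo, ← ENNReal.ofReal_mul (by positivity)]
              congr 1
              field_simp
              ring
          _ ≤ _ := by
              refine setLIntegral_mono' measurableSet_Ioo fun s hs => ?_
              refine le_trans ?_ (hfh s hs.1).1
              refine le_iSup_of_le k ?_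
              have : 2 * s ≤ a k := by linarith [hs.2]
              simp [g, this]
      calc ENNReal.ofReal ((1 / 2) ^ r * (2 ^ r) ^ k)
          = ENNReal.ofReal ((c k / (2 * b (a k))) ^ r) *
            ENNReal.ofReal ((4 ^ k) ^ r * b (a k) ^ r) := by
            rw [← ENNReal.ofReal_mul (by positivity)]
            congr 1
            rw [← Real.mul_rpow (by positivity) hbk.le,
              ← Real.mul_rpow (by positivity) (by positivity), ← Real.rpow_natCast (2 ^ r),
              ← Real.rpow_mul (by norm_num), mul_comm r, Real.rpow_mul (by norm_num),
              ← Real.mul_rpow (by positivity) (by positivity), Real.rpow_natCast]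
            congr 1
            have : (4 : ℝ) ^ k = 2 ^ k * 2 ^ k := by rw [← mul_pow]; norm_num
            simp only [c, this, one_div, inv_pow]
            field_simp
        _ ≤ ENNReal.ofReal ((c k / (2 * b (a k))) ^ r) *
            ∫⁻ t in Ioi (a k), ENNReal.ofReal (t⁻¹ * b t ^ r) := by
            gcongr
            exact hbig k
        _ = ∫⁻ t in Ioi (a k), ENNReal.ofReal ((c k / (2 * b (a k))) ^ r) *
            ENNReal.ofReal (t⁻¹ * b t ^ r) := (lintegral_const_mul' _ _ ofReal_ne_top).symm
        _ ≤ ∫⁻ t in Ioi (a k),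
            (ENNReal.ofReal (t ^ (1 - r⁻¹) * b t) * maxf μ f t) ^ r := by
            refine setLIntegral_mono' measurableSet_Ioi fun t ht => ?_
            have hat : a k < t := ht
            have ht0 : 0 < t := hak.trans hat
            have hbt := hb.pos ht0
            have hmax : ENNReal.ofReal (t⁻¹ * (c k / (2 * b (a k)))) ≤ maxf μ f t := by
              rw [ENNReal.ofReal_mul (by positivity), ENNReal.ofReal_inv_of_pos ht0, maxf]
              gcongr
              exact hF.trans (lintegral_mono_set (Ioo_subset_Ioo_right (by linarith)))
            calc _ = (ENNReal.ofReal (t ^ (1 - r⁻¹) * b t) *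
                  ENNReal.ofReal (t⁻¹ * (c k / (2 * b (a k))))) ^ r := by
                  rw [← ENNReal.ofReal_mul (by positivity), ← ENNReal.ofReal_mul (by positivity),
                    ENNReal.ofReal_rpow_of_pos (by positivity)]
                  congr 1
                  have e : t⁻¹ = (t ^ (1 - r⁻¹) * t⁻¹) ^ r := by
                    rw [← div_eq_mul_inv, ← Real.rpow_sub_one ht0.ne', ← Real.rpow_mul ht0.le,
                      show (1 - r⁻¹ - 1) * r = -1 by field_simp; ring, Real.rpow_neg_one]
                  conv_lhs => rw [e]
                  rw [← Real.mul_rpow (by positivity) hbt.le,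
                    ← Real.mul_rpow (by positivity) (by positivity)]
                  congr 1
                  ring
              _ ≤ _ := by gcongr
        _ ≤ _ := lintegral_mono_set (Ioi_subset_Ioi hak.le)
    refine ENNReal.eq_top_of_forall_nnreal_le fun x => ?_
    obtain ⟨k, hk'⟩ := pow_unbounded_of_one_lt ((x : ℝ) / (1 / 2) ^ r)
      (Real.one_lt_rpow one_lt_two hr)
    refine le_trans ?_ (hk k)
    rw [div_lt_iff₀' (by positivity)] at hk'
    rw [← ENNReal.ofReal_coe_nnreal]
    exact ENNReal.ofReal_le_ofReal hk'.le

end Witnesses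

/-- Theorem T3EQN: for `p = 1` the spaces `L^{(1,q,b)}` and `L^{1,q,b}`
never coincide. -/
theorem lk_p_one_never_eq {X : Type*} [MeasurableSpace X] (μ : Measure X)
    [SigmaFinite μ] (hna : IsNonatomic μ) (hμ : μ Set.univ = ∞)
    (q : ℝ≥0∞) (hq : 0 < q) (b : ℝ → ℝ) (hb : IsSlowlyVarying b) :
    {f : X → ℝ | Measurable f ∧ lkMaxNorm μ 1 q b f < ∞} ≠
      {f : X → ℝ | Measurable f ∧ lkNorm μ 1 q b f < ∞} := by
  obtain ⟨f, hf, hfin, htop⟩ : ∃ f : X → ℝ,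
      Measurable f ∧ lkNorm μ 1 q b f < ∞ ∧ lkMaxNorm μ 1 q b f = ∞ := by
    rcases eq_or_ne q ∞ with rfl | hq'
    · exact hb.exists_lkNorm_lt_top_lkMaxNorm_eq_top_of_eq_top hna hμ
    · exact hb.exists_lkNorm_lt_top_lkMaxNorm_eq_top_of_ne_top hna hμ hq hq'
  intro heq
  have hmem : f ∈ {f : X → ℝ | Measurable f ∧ lkMaxNorm μ 1 q b f < ∞} := heq ▸ ⟨hf, hfin⟩
  exact hmem.2.ne htop
end

section
/- Let b be a slowly varying function, q ∈ (0,∞], and p ∈ (0,1). Then the associate space of L^{p,q,b} is trivial: (L^{p,q,b})' = {0}; that is, for every μ-measurable f which is not zero μ-a.e. one has sup{ ∫_R |f g| dμ : ‖g‖_{p,q,b} ≤ 1 } = ∞. -/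
open MeasureTheory Set Filter ENNReal Topology

/-- The `L^q` functional is monotone on measurable sets. -/
theorem lqNorm_mono (q : ℝ≥0∞) {S : Set ℝ} (hS : MeasurableSet S) {g h : ℝ → ℝ≥0∞}
    (hgh : ∀ t ∈ S, g t ≤ h t) : lqNorm q S g ≤ lqNorm q S h := by
  unfold lqNorm
  split_ifs with hq
  · exact essSup_mono_ae ((ae_restrict_iff' hS).2 (ae_of_all _ hgh))
  · gcongr ?_ ^ _
    exact setLIntegral_mono' hS fun t ht => ENNReal.rpow_le_rpow (hgh t ht) toReal_nonneg

/-- The `L^q` functional of a truncated power `t ^ (r - 1/q)` on `(0, m)` is `O(m ^ r)`. -/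
theorem exists_lqNorm_truncated_rpow_le {q : ℝ≥0∞} (hq : 0 < q) {r : ℝ} (hr : 0 < r) :
    ∃ K : ℝ, 0 < K ∧ ∀ a m : ℝ, 0 < a → 0 < m →
      lqNorm q (Ioi 0) ((Ioo 0 m).indicator
        fun t => ENNReal.ofReal (a * t ^ (r - q⁻¹.toReal))) ≤
      ENNReal.ofReal (K * a * m ^ r) := by
  by_cases hq' : q = ∞
  · refine ⟨1, one_pos, fun a m ha hm => ?_⟩
    simp only [lqNorm, hq', if_true, inv_top, toReal_zero, sub_zero, one_mul]
    refine essSup_le_of_ae_le _ (ae_of_all _ fun t => indicator_apply_le' (fun ht => ?_)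
      (fun _ => zero_le))
    have := ht.1.le
    have := ht.2.le
    change ENNReal.ofReal (a * t ^ r) ≤ ENNReal.ofReal (a * m ^ r)
    gcongr
  · have hQ : 0 < q.toReal := toReal_pos hq.ne' hq'
    set Q := q.toReal with hQdef
    have hrQ : 0 < r * Q := mul_pos hr hQ
    refine ⟨(r * Q)⁻¹ ^ (1 / Q), by positivity, fun a m ha hm => ?_⟩
    simp only [lqNorm, hq', if_false, toReal_inv, ← hQdef]
    have hpow : ∀ t : ℝ, (Ioo 0 m).indicator
        (fun t => ENNReal.ofReal (a * t ^ (r - Q⁻¹))) t ^ Q =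
        (Ioo 0 m).indicator (fun t => ENNReal.ofReal (a ^ Q * t ^ (r * Q - 1))) t := by
      intro t
      by_cases ht : t ∈ Ioo 0 m
      · have ht0 : 0 < t := ht.1
        rw [indicator_of_mem ht, indicator_of_mem ht,
          ENNReal.ofReal_rpow_of_nonneg (by positivity) hQ.le,
          Real.mul_rpow ha.le (by positivity), ← Real.rpow_mul ht0.le, sub_mul,
          inv_mul_cancel₀ hQ.ne']
      · rw [indicator_of_notMem ht, indicator_of_notMem ht, ENNReal.zero_rpow_of_pos hQ]
    have hint : ∫⁻ t in Ioo 0 m, ENNReal.ofReal (a ^ Q * t ^ (r * Q - 1)) =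
        ENNReal.ofReal (a ^ Q * (m ^ (r * Q) / (r * Q))) := by
      have hi : IntervalIntegrable (fun t : ℝ => a ^ Q * t ^ (r * Q - 1)) volume 0 m :=
        (intervalIntegral.intervalIntegrable_rpow' (by linarith)).const_mul _
      rw [intervalIntegrable_iff_integrableOn_Ioo_of_le hm.le] at hi
      rw [← ofReal_integral_eq_lintegral_ofReal hi, ← integral_Ioc_eq_integral_Ioo,
        ← intervalIntegral.integral_of_le hm.le, intervalIntegral.integral_const_mul,
        integral_rpow (Or.inl (by linarith)), sub_add_cancel, Real.zero_rpow hrQ.ne', sub_zero]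
      filter_upwards [ae_restrict_mem measurableSet_Ioo] with t ht
      have := ht.1
      positivity
    simp only [hpow]
    rw [lintegral_indicator measurableSet_Ioo,
      Measure.restrict_restrict_of_subset Ioo_subset_Ioi_self, hint,
      ENNReal.ofReal_rpow_of_nonneg (by positivity) (by positivity)]
    apply ENNReal.ofReal_le_ofReal (le_of_eq _)
    rw [Real.mul_rpow (by positivity) (by positivity), div_eq_mul_inv (m ^ (r * Q)),
      Real.mul_rpow (by positivity) (by positivity), ← Real.rpow_mul ha.le,
      ← Real.rpow_mul hm.le, mul_one_div_cancel hQ.ne', Real.rpow_one, mul_assoc r,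
      mul_one_div_cancel hQ.ne', mul_one]
    ring

/-- The rearrangement of `c * 1_E` is at most `c * 1_(0, μ E)`. -/
theorem rearr_indicator_const_le {X : Type*} [MeasurableSpace X] (μ : Measure X) {E : Set X}
    {c m t : ℝ} (hc : 0 < c) (hE : μ E = ENNReal.ofReal m) (ht : 0 < t) :
    rearr μ (E.indicator fun _ => c) t ≤ (Ioo 0 m).indicator (fun _ => ENNReal.ofReal c) t := by
  by_cases htm : t < m
  · rw [indicator_of_mem (mem_Ioo.2 ⟨ht, htm⟩)]
    refine sInf_le ?_
    have hempty : {x | ENNReal.ofReal c < ENNReal.ofReal |E.indicator (fun _ => c) x|} = ∅ := by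
      refine eq_empty_of_forall_notMem fun x hx => ?_
      refine hx.not_ge (ENNReal.ofReal_le_ofReal ?_)
      by_cases hxE : x ∈ E <;> simp [hxE, abs_of_pos hc, hc.le]
    simp only [mem_ofPred_eq, hempty, measure_empty, zero_le]
  · rw [indicator_of_notMem fun h => htm h.2]
    refine sInf_le ((measure_mono fun x hx => ?_).trans
      (hE.le.trans (ENNReal.ofReal_le_ofReal (not_lt.1 htm))))
    by_contra hxE
    simp [hxE] at hx

/-- A slowly varying function is `O(t ^ (-ε))` on `(0, 1]`. -/
theorem IsSlowlyVarying.exists_le_rpow_neg {b : ℝ → ℝ} (hb : IsSlowlyVarying b) {ε : ℝ}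
    (hε : 0 < ε) : ∃ C : ℝ, 0 < C ∧ ∀ t : ℝ, 0 < t → t ≤ 1 → b t ≤ C * t ^ (-ε) := by
  obtain ⟨bp, hmono, c, C, hc, hC, h⟩ := (hb.2.2 ε hε).1
  have h1 : 0 < bp 1 := by
    have hle := (h 1 (mem_Ioi.2 one_pos)).2
    have hb1 := hb.2.1 1 (mem_Ioi.2 one_pos)
    simp only [Real.one_rpow, one_mul] at hle
    exact pos_of_mul_pos_right (hb1.trans_le hle) hC.le
  refine ⟨C * bp 1, by positivity, fun t ht ht1 => ?_⟩
  have hle : t ^ ε * b t ≤ C * bp 1 := (h t ht).2.trans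
    (mul_le_mul_of_nonneg_left (hmono ht (mem_Ioi.2 one_pos) ht1) hC.le)
  rw [Real.rpow_neg ht.le, ← div_eq_mul_inv, le_div_iff₀ (by positivity)]
  linarith

/-- For `p < 1`, the Lorentz–Karamata functional of `c * 1_E` is `O(c * μ(E) ^ r)` for some
`r > 1`, as long as `μ E ≤ 1`. -/
theorem exists_lkNorm_indicator_const_le {X : Type*} [MeasurableSpace X] (μ : Measure X)
    {p q : ℝ≥0∞} (hp : 0 < p) (hp1 : p < 1) (hq : 0 < q) {b : ℝ → ℝ} (hb : IsSlowlyVarying b) :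
    ∃ K r : ℝ, 0 < K ∧ 1 < r ∧ ∀ (E : Set X) (c m : ℝ), 0 < c → 0 < m → m ≤ 1 →
      μ E = ENNReal.ofReal m →
      lkNorm μ p q b (E.indicator fun _ => c) ≤ ENNReal.ofReal (K * c * m ^ r) := by
  have hP : 1 < p⁻¹.toReal := by
    rw [toReal_inv]
    exact (one_lt_inv₀ (toReal_pos hp.ne' hp1.ne_top)).2
      (by simpa using (toReal_lt_toReal hp1.ne_top one_ne_top).2 hp1)
  set P := p⁻¹.toReal with hPdef
  obtain ⟨C, hC, hbC⟩ := hb.exists_le_rpow_neg (ε := (P - 1) / 2) (by linarith)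
  obtain ⟨K, hK, hKle⟩ := exists_lqNorm_truncated_rpow_le hq (r := (P + 1) / 2) (by linarith)
  refine ⟨K * C, (P + 1) / 2, by positivity, by linarith, fun E c m hc hm hm1 hE => ?_⟩
  rw [mul_assoc K C c]
  refine le_trans (lqNorm_mono q measurableSet_Ioi fun t ht => ?_)
    (hKle (C * c) m (by positivity) hm)
  have ht0 : 0 < t := ht
  refine (mul_le_mul_right (rearr_indicator_const_le μ hc hE ht0) _).trans ?_
  by_cases htm : t ∈ Ioo 0 m
  · rw [indicator_of_mem htm, indicator_of_mem htm, ← ENNReal.ofReal_mul' hc.le]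
    apply ENNReal.ofReal_le_ofReal
    calc t ^ (P - q⁻¹.toReal) * b t * c
        ≤ t ^ (P - q⁻¹.toReal) * (C * t ^ (-((P - 1) / 2))) * c := by
          gcongr
          exact hbC t ht0 (htm.2.le.trans hm1)
      _ = C * c * (t ^ (P - q⁻¹.toReal) * t ^ (-((P - 1) / 2))) := by ring
      _ = C * c * t ^ ((P + 1) / 2 - q⁻¹.toReal) := by
          rw [← Real.rpow_add ht0]
          ring_nf
  · rw [indicator_of_notMem htm, mul_zero]
    exact zero_le

/-- In a non-atomic measure space, every set of finite positive measure has subsets of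
arbitrarily small positive measure. -/
theorem IsNonatomic.exists_subset_measure_le {X : Type*} [MeasurableSpace X] {μ : Measure X}
    (hna : IsNonatomic μ) {A : Set X} (hA : MeasurableSet A) (hA0 : 0 < μ A) (hAtop : μ A < ∞)
    {ε : ℝ≥0∞} (hε : 0 < ε) : ∃ E ⊆ A, MeasurableSet E ∧ 0 < μ E ∧ μ E ≤ ε := by
  have halving : ∀ n : ℕ, ∃ E ⊆ A, MeasurableSet E ∧ 0 < μ E ∧ μ E ≤ 2⁻¹ ^ n * μ A := by
    intro n
    induction n with
    | zero => exact ⟨A, Subset.rfl, hA, hA0, by simp⟩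
    | succ n ih =>
      obtain ⟨E, hEA, hE, hE0, hEle⟩ := ih
      obtain ⟨T, hTE, hT, hT0, hTlt⟩ := hna E hE hE0
      have hadd : μ (E \ T) + μ T = μ E := by
        rw [← measure_sdiff_add_inter E hT, inter_eq_self_of_subset_right hTE]
      have hsdiff0 : 0 < μ (E \ T) := by
        rw [pos_iff_ne_zero]
        intro h0
        rw [h0, zero_add] at hadd
        exact hTlt.ne hadd
      have hhalf : 2⁻¹ * μ E ≤ 2⁻¹ ^ (n + 1) * μ A := by
        rw [pow_succ', mul_assoc]
        gcongr
      rcases le_or_gt (μ T) (2⁻¹ * μ E) with h | h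
      · exact ⟨T, hTE.trans hEA, hT, hT0, h.trans hhalf⟩
      · refine ⟨E \ T, sdiff_subset.trans hEA, hE.diff hT, hsdiff0, le_trans ?_ hhalf⟩
        by_contra! h'
        have hlt := ENNReal.add_lt_add h' h
        rw [hadd, ← add_mul, ENNReal.inv_two_add_inv_two, one_mul] at hlt
        exact hlt.false
  have hlim : Tendsto (fun n : ℕ => (2⁻¹ : ℝ≥0∞) ^ n * μ A) atTop (𝓝 0) := by
    simpa using ENNReal.Tendsto.mul_const
      (ENNReal.tendsto_pow_atTop_nhds_zero_of_lt_one (r := 2⁻¹) (by simp))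
      (Or.inr hAtop.ne)
  obtain ⟨n, hn⟩ := (hlim.eventually_le_const hε).exists
  obtain ⟨E, hEA, hE, hE0, hEle⟩ := halving n
  exact ⟨E, hEA, hE, hE0, hEle.trans hn⟩

/-- A measurable function that does not vanish a.e. is bounded away from zero on a set of
finite positive measure. -/
theorem exists_measurableSet_lt_abs {X : Type*} [MeasurableSpace X] {μ : Measure X}
    [SigmaFinite μ] {f : X → ℝ} (hf : Measurable f) (hf0 : ¬(f =ᵐ[μ] 0)) :
    ∃ (δ : ℝ) (A : Set X), 0 < δ ∧ MeasurableSet A ∧ 0 < μ A ∧ μ A < ∞ ∧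
      ∀ x ∈ A, δ < |f x| := by
  have hcover : {x | f x ≠ 0} ⊆ ⋃ n : ℕ, {x | 1 / ((n : ℝ) + 1) < |f x|} := fun x hx =>
    mem_iUnion.2 (exists_nat_one_div_lt (abs_pos.2 hx))
  obtain ⟨n, hn⟩ := exists_measure_pos_of_not_measure_iUnion_null
    fun h => hf0 (ae_iff.2 (measure_mono_null hcover h))
  obtain ⟨A, hA, hAsub, hA0, hAtop⟩ := Measure.exists_subset_measure_lt_top
    (measurableSet_lt measurable_const (continuous_abs.measurable.comp hf)) hn
  exact ⟨1 / ((n : ℝ) + 1), A, by positivity, hA, hA0, hAtop, fun x hx => hAsub hx⟩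

/-- Proposition PAS: for `p ∈ (0,1)` the associate space of `L^{p,q,b}`
is trivial. -/
theorem lk_assoc_trivial {X : Type*} [MeasurableSpace X] (μ : Measure X)
    [SigmaFinite μ] (hna : IsNonatomic μ) (hμ : μ Set.univ = ∞)
    (p q : ℝ≥0∞) (hp : 0 < p) (hp1 : p < 1) (hq : 0 < q)
    (b : ℝ → ℝ) (hb : IsSlowlyVarying b) :
    ∀ f : X → ℝ, Measurable f → ¬(f =ᵐ[μ] 0) →
      assocNorm μ (lkNorm μ p q b) f = ∞ := by
  intro f hf hf0
  obtain ⟨δ, A, hδ, hA, hA0, hAtop, hAf⟩ := exists_measurableSet_lt_abs hf hf0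
  obtain ⟨K, r, hK, hr, hnorm⟩ := exists_lkNorm_indicator_const_le μ hp hp1 hq hb
  have hr1 : 0 < r - 1 := by linarith
  refine ENNReal.eq_top_of_forall_nnreal_le fun M₀ => ?_
  set M : ℝ := M₀ + 1 with hM
  have hM0 : 0 < M := by positivity
  set η : ℝ := min 1 ((δ / (K * M)) ^ (r - 1)⁻¹) with hη
  have hη0 : 0 < η := by positivity
  obtain ⟨E, hEA, hE, hE0, hEle⟩ :=
    hna.exists_subset_measure_le hA hA0 hAtop (ENNReal.ofReal_pos.2 hη0)
  have hEtop : μ E ≠ ∞ := (hEle.trans_lt ofReal_lt_top).ne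
  set m : ℝ := (μ E).toReal with hmdef
  have hm0 : 0 < m := toReal_pos hE0.ne' hEtop
  have hEm : μ E = ENNReal.ofReal m := (ofReal_toReal hEtop).symm
  have hmη : m ≤ η := toReal_le_of_le_ofReal hη0.le hEle
  have hsmall : m ^ (r - 1) ≤ δ / (K * M) := by
    calc m ^ (r - 1) ≤ ((δ / (K * M)) ^ (r - 1)⁻¹) ^ (r - 1) := by
          gcongr
          exact hmη.trans (min_le_right _ _)
      _ = δ / (K * M) := Real.rpow_inv_rpow (by positivity) hr1.ne'
  set c : ℝ := (K * m ^ r)⁻¹ with hcdef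
  have hc : 0 < c := by positivity
  have hg : lkNorm μ p q b (E.indicator fun _ => c) ≤ 1 := by
    refine (hnorm E c m hc hm0 (hmη.trans (min_le_left _ _)) hEm).trans ?_
    rw [mul_right_comm, hcdef, mul_inv_cancel₀ (by positivity), ENNReal.ofReal_one]
  have hlarge : M ≤ δ * c * m := by
    have hmr : m ^ r = m ^ (r - 1) * m := by
      rw [← Real.rpow_add_one hm0.ne', sub_add_cancel]
    rw [le_div_iff₀ (by positivity)] at hsmall
    rw [hcdef, hmr, mul_assoc, inv_mul_eq_div, mul_div_assoc', le_div_iff₀ (by positivity)]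
    nlinarith
  calc (M₀ : ℝ≥0∞) = ENNReal.ofReal M₀ := ENNReal.ofReal_coe_nnreal.symm
    _ ≤ ENNReal.ofReal (δ * c * m) := ENNReal.ofReal_le_ofReal (by linarith)
    _ = ∫⁻ _ in E, ENNReal.ofReal (δ * c) ∂μ := by
        rw [setLIntegral_const, hEm, ENNReal.ofReal_mul (by positivity)]
    _ ≤ ∫⁻ x in E, ENNReal.ofReal |f x * E.indicator (fun _ => c) x| ∂μ := by
        refine setLIntegral_mono' hE fun x hx => ENNReal.ofReal_le_ofReal ?_
        rw [indicator_of_mem hx, abs_mul, abs_of_pos hc]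
        exact mul_le_mul_of_nonneg_right (hAf x (hEA hx)).le hc.le
    _ ≤ ∫⁻ x, ENNReal.ofReal |f x * E.indicator (fun _ => c) x| ∂μ := setLIntegral_le_lintegral _ _
    _ ≤ assocNorm μ (lkNorm μ p q b) f :=
        le_iSup_of_le _ (le_iSup₂_of_le (measurable_const.indicator hE) hg le_rfl)
end
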